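/- For every integer m ≥ 1 and over any commutative ring, U_{2m−1}(x) − 1 = (−1)^m · A_{m−1}(x) · A_m(−x), where A_m(x) = U_m(x) + U_{m−1}(x). -/

import Mathlib

open Polynomial Polynomial.Chebyshev

theorem chebyshev_U_add (R : Type*) [CommRing R] (m : ℤ) (n : ℕ) :
    U R (m + n) = U R m * U R n - U R (m - 1) * U R ((n : ℤ) - 1) := by
  induction n using Nat.twoStepInduction with
  | zero => simp
  | one => simp [U_add_one, mul_comm]
  | more n ih₀ ih₁ =>
    have h := U_add_two R (m + n)
    have h₀ := U_add_two R n
    have h₁ := U_add_one R n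
    push_cast at ih₁ ⊢
    rw [show (n : ℤ) + 1 - 1 = n by ring, ← add_assoc] at ih₁
    rw [show (n : ℤ) + 2 - 1 = n + 1 by ring, ← add_assoc]
    linear_combination h + 2 * X * ih₁ - ih₀ - U R m * h₀ + U R (m - 1) * h₁

theorem chebyshev_U_sq_sub_mul (R : Type*) [CommRing R] (n : ℕ) :
    U R n ^ 2 - U R ((n : ℤ) - 1) * U R ((n : ℤ) + 1) = 1 := by
  induction n with
  | zero => simp
  | succ n ih =>
    have h₀ := U_add_one R n
    have h₁ := U_add_two R n
    push_cast
    rw [show (n : ℤ) + 1 - 1 = n by ring, show (n : ℤ) + 1 + 1 = n + 2 by ring]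
    linear_combination ih + U R ((n : ℤ) + 1) * h₀ - U R n * h₁

theorem chebyshev_U_comp_neg_X (R : Type*) [CommRing R] (n : ℕ) :
    (U R n).comp (-X) = (-1) ^ n * U R n := by
  induction n using Nat.twoStepInduction with
  | zero => simp
  | one => simp
  | more n ih₀ ih₁ =>
    push_cast at ih₁ ⊢
    simp only [U_add_two, sub_comp, mul_comp, X_comp, ofNat_comp, ih₀, ih₁]
    ring

/-- For every integer `m ≥ 1` and over any commutative ring,
`U (2m-1) - 1 = (-1)^m * A_{m-1}(x) * A_m(-x)`, where `A_m(x) = U_m(x) + U_{m-1}(x)`. -/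
theorem chebyshev_U_odd_sub_one_factorization (R : Type*) [CommRing R] (m : ℕ) (hm : 1 ≤ m) :
    U R (2 * m - 1) - 1 =
      (-1) ^ m * (U R ((m : ℤ) - 1) + U R ((m : ℤ) - 2)) *
        ((U R m + U R ((m : ℤ) - 1)).comp (-X)) := by
  obtain ⟨k, rfl⟩ := Nat.exists_eq_add_of_le' hm
  have hadd := chebyshev_U_add R ((k : ℤ) + 1) k
  have hsq := chebyshev_U_sq_sub_mul R k
  have hc := chebyshev_U_comp_neg_X R k
  have hc' := chebyshev_U_comp_neg_X R (k + 1)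
  have hsign : ((-1 : R[X]) ^ k) ^ 2 = 1 := by rw [← pow_mul, mul_comm, pow_mul]; simp
  push_cast at hc' ⊢
  rw [show (k : ℤ) + 1 - 1 = k by ring] at hadd ⊢
  rw [show (k : ℤ) + 1 - 2 = k - 1 by ring,
    show 2 * ((k : ℤ) + 1) - 1 = k + 1 + k by ring, hadd, add_comp, hc, hc']
  rw [pow_succ]
  linear_combination hsq - (U R (k : ℤ) + U R ((k : ℤ) - 1)) *
    (U R ((k : ℤ) + 1) - U R (k : ℤ)) * hsign
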